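/- arXiv:1507.07196 — 9 statements merged into one kernel-verified Lean document; each statement's English description precedes it below -/
import Mathlib

section
/- Let ρ be a complex matrix on the bipartite index set α × β (with α, β finite), let Ã₁, Ã₂ be complex matrices on α, and let π₁, π₂ be complex matrices on β. Suppose that ρ · (1 ⊗ π₁) = (1 ⊗ π₁) · ρ = Ã₁ ⊗ π₁ and ρ · (1 ⊗ π₂) = (1 ⊗ π₂) · ρ = Ã₂ ⊗ π₂ (Kronecker products, with 1 the identity matrix on α). If Ã₁ ≠ Ã₂, then π₂ · π₁ = 0; in particular Tr(π₂ · π₁) = 0. -/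
open Kronecker Matrix

/-- A nonzero right Kronecker factor can be cancelled. -/
theorem kronecker_right_cancel {R l m n p : Type*} [MulZeroClass R] [IsRightCancelMulZero R]
    {A B : Matrix l m R} {C : Matrix n p R} (hC : C ≠ 0) (h : A ⊗ₖ C = B ⊗ₖ C) : A = B := by
  obtain ⟨k, q, hkq⟩ : ∃ k q, C k q ≠ 0 := by
    by_contra! hzero
    exact hC (Matrix.ext hzero)
  ext i j
  exact mul_right_cancel₀ hkq (congrFun₂ h (i, k) (j, q))

/-- Lemma 1: subsystem eigenprojectors corresponding to distinct
subsystem operator-valued eigenvalues are orthogonal. -/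
theorem stmt_0 {α β : Type*} [Fintype α] [Fintype β] [DecidableEq α] [DecidableEq β]
    (ρ : Matrix (α × β) (α × β) ℂ)
    (A₁ A₂ : Matrix α α ℂ) (π₁ π₂ : Matrix β β ℂ)
    (h1r : ρ * ((1 : Matrix α α ℂ) ⊗ₖ π₁) = A₁ ⊗ₖ π₁)
    (h1l : ((1 : Matrix α α ℂ) ⊗ₖ π₁) * ρ = A₁ ⊗ₖ π₁)
    (h2r : ρ * ((1 : Matrix α α ℂ) ⊗ₖ π₂) = A₂ ⊗ₖ π₂)
    (h2l : ((1 : Matrix α α ℂ) ⊗ₖ π₂) * ρ = A₂ ⊗ₖ π₂)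
    (hne : A₁ ≠ A₂) :
    π₂ * π₁ = 0 ∧ (π₂ * π₁).trace = 0 := by
  have key : A₁ ⊗ₖ (π₂ * π₁) = A₂ ⊗ₖ (π₂ * π₁) :=
    calc A₁ ⊗ₖ (π₂ * π₁)
        = ((1 : Matrix α α ℂ) ⊗ₖ π₂) * (A₁ ⊗ₖ π₁) := by
          rw [← mul_kronecker_mul, Matrix.one_mul]
      _ = (A₂ ⊗ₖ π₂) * ((1 : Matrix α α ℂ) ⊗ₖ π₁) := by
          rw [← h1r, ← Matrix.mul_assoc, h2l]
      _ = A₂ ⊗ₖ (π₂ * π₁) := by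
          rw [← mul_kronecker_mul, Matrix.mul_one]
  have hzero : π₂ * π₁ = 0 := by
    by_contra hπ
    exact hne (kronecker_right_cancel hπ key)
  exact ⟨hzero, by rw [hzero, trace_zero]⟩
end

section
/- Let α, β be finite types and let ρ be a complex matrix on α × β. Suppose ρ = Σ_{k∈K} A_k ⊗ Π_k and ρ = Σ_{l∈L} B_l ⊗ Σ_l are two decompositions in which: the A_k are pairwise-distinct matrices on α and the B_l are pairwise-distinct matrices on α; {Π_k}_{k∈K} and {Σ_l}_{l∈L} are families of nonzero orthogonal projections on β that are pairwise orthogonal within each family and sum to the identity. Then there is a bijection φ : K → L with B_{φ(k)} = A_k and Σ_{φ(k)} = Π_k for every k ∈ K. -/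
open Kronecker Matrix

/-- If two sums of Kronecker products over families of mutually orthogonal idempotents agree, then
the coefficients attached to idempotents with nonzero product coincide. -/
theorem coeff_eq_of_mul_ne_zero {α β K L R : Type*} [Fintype β] [Fintype K] [Fintype L]
    [CommRing R] [IsDomain R]
    {A : K → Matrix α α R} {B : L → Matrix α α R}
    {P : K → Matrix β β R} {S : L → Matrix β β R}
    (hPidem : ∀ k, P k * P k = P k) (hPorth : ∀ k k', k ≠ k' → P k * P k' = 0)
    (hSidem : ∀ l, S l * S l = S l) (hSorth : ∀ l l', l ≠ l' → S l * S l' = 0)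
    (h : ∑ k, A k ⊗ₖ P k = ∑ l, B l ⊗ₖ S l) {k : K} {l : L} (hkl : P k * S l ≠ 0) :
    A k = B l := by
  ext i j
  have hblock : ∑ k, A k i j • P k = ∑ l, B l i j • S l := by
    ext x y
    simpa [Matrix.sum_apply] using congrFun (congrFun h (i, x)) (j, y)
  have hleft : P k * ∑ k, A k i j • P k = A k i j • P k := by
    rw [Finset.mul_sum, Fintype.sum_eq_single k fun k' hk' => by
      rw [Matrix.mul_smul, hPorth k k' hk'.symm, smul_zero], Matrix.mul_smul, hPidem]
  have hright : (∑ l, B l i j • S l) * S l = B l i j • S l := by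
    rw [Finset.sum_mul, Fintype.sum_eq_single l fun l' hl' => by
      rw [Matrix.smul_mul, hSorth l' l hl', smul_zero], Matrix.smul_mul, hSidem]
  have hsmul : A k i j • (P k * S l) = B l i j • (P k * S l) := by
    rw [← Matrix.smul_mul, ← hleft, hblock, Matrix.mul_assoc, hright, Matrix.mul_smul]
  exact smul_left_injective R hkl hsmul

/-- Lemma 2 (uniqueness): a quantum-classical state possesses a unique FRASE
decomposition. -/
theorem stmt_2 {α β K L : Type*} [Fintype α] [Fintype β] [Fintype K] [Fintype L]
    [DecidableEq α] [DecidableEq β]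
    (ρ : Matrix (α × β) (α × β) ℂ)
    (A : K → Matrix α α ℂ) (B : L → Matrix α α ℂ)
    (P : K → Matrix β β ℂ) (S : L → Matrix β β ℂ)
    (hA : Function.Injective A) (hB : Function.Injective B)
    (hPherm : ∀ k, (P k)ᴴ = P k) (hPidem : ∀ k, P k * P k = P k)
    (hPne : ∀ k, P k ≠ 0) (hPorth : ∀ k k', k ≠ k' → P k * P k' = 0)
    (hPsum : ∑ k, P k = 1)
    (hSherm : ∀ l, (S l)ᴴ = S l) (hSidem : ∀ l, S l * S l = S l)
    (hSne : ∀ l, S l ≠ 0) (hSorth : ∀ l l', l ≠ l' → S l * S l' = 0)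
    (hSsum : ∑ l, S l = 1)
    (hρP : ρ = ∑ k, A k ⊗ₖ P k) (hρS : ρ = ∑ l, B l ⊗ₖ S l) :
    ∃ φ : K ≃ L, ∀ k, B (φ k) = A k ∧ S (φ k) = P k := by
  have hAB : ∀ {k l}, P k * S l ≠ 0 → A k = B l := fun hkl =>
    coeff_eq_of_mul_ne_zero hPidem hPorth hSidem hSorth (hρP.symm.trans hρS) hkl
  have hP : ∀ k, P k = ∑ l, P k * S l := fun k => by
    rw [← Finset.mul_sum, hSsum, Matrix.mul_one]
  have hS : ∀ l, S l = ∑ k, P k * S l := fun l => by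
    rw [← Finset.sum_mul, hPsum, Matrix.one_mul]
  have hexL : ∀ k, ∃ l, P k * S l ≠ 0 := fun k => by
    by_contra! hzero
    exact hPne k ((hP k).trans (Finset.sum_eq_zero fun l _ => hzero l))
  have hexK : ∀ l, ∃ k, P k * S l ≠ 0 := fun l => by
    by_contra! hzero
    exact hSne l ((hS l).trans (Finset.sum_eq_zero fun k _ => hzero k))
  choose φ hφ using hexL
  have hbij : Function.Bijective φ := by
    refine ⟨fun k k' hk => hA ?_, fun l => ?_⟩
    · rw [hAB (hφ k), hAB (hφ k'), hk]
    · obtain ⟨k, hk⟩ := hexK l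
      exact ⟨k, hB ((hAB (hφ k)).symm.trans (hAB hk))⟩
  refine ⟨Equiv.ofBijective φ hbij, fun k => ⟨(hAB (hφ k)).symm, ?_⟩⟩
  have hPmul : P k = P k * S (φ k) :=
    (hP k).trans <| Fintype.sum_eq_single _ fun l hl => by
      by_contra hne
      exact hl (hB ((hAB hne).symm.trans (hAB (hφ k))))
  have hSmul : S (φ k) = P k * S (φ k) :=
    (hS (φ k)).trans <| Fintype.sum_eq_single _ fun k' hk' => by
      by_contra hne
      exact hk' (hA ((hAB hne).trans (hAB (hφ k)).symm))
  exact hSmul.trans hPmul.symm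
end

section
/- Let α, β be finite types and suppose ρ = Σ_k A_k ⊗ Π_k is a complex matrix on α × β, where the A_k are pairwise-distinct matrices on α and the Π_k are nonzero orthogonal projections on β, pairwise orthogonal and summing to the identity. If S is a unitary matrix on β such that (1 ⊗ S) · ρ · (1 ⊗ S)† = ρ, then S · Π_k · S† = Π_k for every k. -/
open Kronecker Matrix

theorem sum_smul_mul_eq_of_sum_kronecker_eq {α β K : Type*} [Fintype K]
    {A : K → Matrix α α ℂ} {P Q : K → Matrix β β ℂ}
    (h : ∑ k, A k ⊗ₖ P k = ∑ k, A k ⊗ₖ Q k) (i j : α) :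
    ∑ k, A k i j • P k = ∑ k, A k i j • Q k := by
  ext b c
  have := congrFun (congrFun h (i, b)) (j, c)
  simpa [Matrix.sum_apply] using this

/-- A matrix commuting with a combination of orthogonal idempotents has no block between two
idempotents with different coefficients. -/
theorem mul_mul_eq_zero_of_commute_sum_smul {β K : Type*} [Fintype β] [Fintype K]
    {a : K → ℂ} {P : K → Matrix β β ℂ} {S : Matrix β β ℂ}
    (hPidem : ∀ k, P k * P k = P k) (hPorth : ∀ k k', k ≠ k' → P k * P k' = 0)
    (h : S * ∑ k, a k • P k = (∑ k, a k • P k) * S) {k l : K} (hkl : a k ≠ a l) :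
    P k * S * P l = 0 := by
  have hright : (∑ m, a m • P m) * P l = a l • P l := by
    rw [Finset.sum_mul, Finset.sum_eq_single l]
    · rw [smul_mul_assoc, hPidem]
    · intro m _ hm
      rw [smul_mul_assoc, hPorth m l hm, smul_zero]
    · simp
  have hleft : P k * (∑ m, a m • P m) = a k • P k := by
    rw [Finset.mul_sum, Finset.sum_eq_single k]
    · rw [mul_smul_comm, hPidem]
    · intro m _ hm
      rw [mul_smul_comm, hPorth k m hm.symm, smul_zero]
    · simp
  have key : a l • (P k * S * P l) = a k • (P k * S * P l) := by
    calc a l • (P k * S * P l) = P k * (S * ∑ m, a m • P m) * P l := by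
          simp only [Matrix.mul_assoc, hright, mul_smul_comm]
      _ = a k • (P k * S * P l) := by
          rw [h, ← Matrix.mul_assoc (P k), hleft, smul_mul_assoc, smul_mul_assoc]
  rw [← sub_eq_zero, ← sub_smul] at key
  exact (smul_eq_zero.mp key).resolve_left (sub_ne_zero.mpr hkl.symm)

/-- A matrix that is block diagonal for a complete family commutes with its members. -/
theorem mul_eq_mul_of_blocks_eq_zero {β K : Type*} [Fintype β] [DecidableEq β] [Fintype K]
    {P : K → Matrix β β ℂ} {S : Matrix β β ℂ} (hPsum : ∑ k, P k = 1)
    (h : ∀ k l, k ≠ l → P k * S * P l = 0) (k : K) : S * P k = P k * S := by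
  have hleft : S * P k = P k * S * P k := by
    calc S * P k = ∑ m, P m * S * P k := by
          rw [← Finset.sum_mul, ← Finset.sum_mul, hPsum, Matrix.one_mul]
      _ = P k * S * P k := Finset.sum_eq_single k (fun m _ hm => h m k hm) (by simp)
  have hright : P k * S = P k * S * P k := by
    calc P k * S = ∑ m, P k * S * P m := by
          rw [← Finset.mul_sum, hPsum, Matrix.mul_one]
      _ = P k * S * P k := Finset.sum_eq_single k (fun m _ hm => h k m hm.symm) (by simp)
  rw [hleft, ← hright]

/-- Section II: any symmetry of ρ with support on the subsystem b leaves each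
FRASE invariant. -/
theorem stmt_3 {α β K : Type*} [Fintype α] [Fintype β] [Fintype K]
    [DecidableEq α] [DecidableEq β]
    (ρ : Matrix (α × β) (α × β) ℂ)
    (A : K → Matrix α α ℂ) (P : K → Matrix β β ℂ)
    (hA : Function.Injective A)
    (hPherm : ∀ k, (P k)ᴴ = P k) (hPidem : ∀ k, P k * P k = P k)
    (hPne : ∀ k, P k ≠ 0) (hPorth : ∀ k k', k ≠ k' → P k * P k' = 0)
    (hPsum : ∑ k, P k = 1)
    (hρ : ρ = ∑ k, A k ⊗ₖ P k)
    (S : Matrix β β ℂ) (hS : S ∈ Matrix.unitaryGroup β ℂ)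
    (hsym : ((1 : Matrix α α ℂ) ⊗ₖ S) * ρ * ((1 : Matrix α α ℂ) ⊗ₖ S)ᴴ = ρ) :
    ∀ k, S * P k * Sᴴ = P k := by
  have hSS : S * Sᴴ = 1 := Matrix.mem_unitaryGroup_iff.mp hS
  have hSS' : Sᴴ * S = 1 := Matrix.mem_unitaryGroup_iff'.mp hS
  have hcomm : ((1 : Matrix α α ℂ) ⊗ₖ S) * ρ = ρ * ((1 : Matrix α α ℂ) ⊗ₖ S) := by
    conv_rhs => rw [← hsym]
    rw [Matrix.mul_assoc _ _ ((1 : Matrix α α ℂ) ⊗ₖ S), Matrix.conjTranspose_kronecker,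
      ← Matrix.mul_kronecker_mul, hSS', Matrix.conjTranspose_one, Matrix.one_mul,
      Matrix.one_kronecker_one, Matrix.mul_one]
  have hblock : ∑ k, A k ⊗ₖ (S * P k) = ∑ k, A k ⊗ₖ (P k * S) := by
    simpa only [hρ, Finset.mul_sum, Finset.sum_mul, ← Matrix.mul_kronecker_mul, Matrix.one_mul,
      Matrix.mul_one] using hcomm
  have hzero : ∀ k l, k ≠ l → P k * S * P l = 0 := by
    intro k l hkl
    obtain ⟨i, j, hij⟩ : ∃ i j, A k i j ≠ A l i j := by
      by_contra! hall
      exact hkl (hA (Matrix.ext hall))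
    refine mul_mul_eq_zero_of_commute_sum_smul (a := fun m => A m i j) hPidem hPorth ?_ hij
    simpa only [Finset.mul_sum, Finset.sum_mul, mul_smul_comm, smul_mul_assoc] using
      sum_smul_mul_eq_of_sum_kronecker_eq hblock i j
  intro k
  rw [mul_eq_mul_of_blocks_eq_zero hPsum hzero k, Matrix.mul_assoc, hSS, Matrix.mul_one]
end

section
/- Let β be a finite type, let {Π_k} be a family of orthogonal projections24 on β that are pairwise orthogonal and sum to the identity, and let G, L, L', D be unitary matrices on β. Suppose that for every k, G·Π_k·G† = L'·D·(L†·Π_k·L)·D†·L'†. Then the unitary B := D†·L'†·G·L commutes with X_k := L†·Π_k·L for every k; consequently, G = L'·D·B·L† with B block diagonal with respect to the projections X_k. -/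
open Matrix

/-- Lemma of Section IV.A (gate decomposition): if G maps each FRASE Π_k to
L'D(L†Π_kL)D†L'†, then B = D†L'†GL commutes with every X_k = L†Π_kL, and
G = L'DBL† with B block diagonal with respect to the X_k. -/
theorem stmt_7 {β K : Type*} [Fintype β] [DecidableEq β] [Fintype K]
    (P : K → Matrix β β ℂ)
    (hPherm : ∀ k, (P k)ᴴ = P k) (hPidem : ∀ k, P k * P k = P k)
    (hPorth : ∀ k k', k ≠ k' → P k * P k' = 0)
    (hPsum : ∑ k, P k = 1)
    (G L L' D : Matrix β β ℂ)
    (hG : G ∈ Matrix.unitaryGroup β ℂ) (hL : L ∈ Matrix.unitaryGroup β ℂ)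
    (hL' : L' ∈ Matrix.unitaryGroup β ℂ) (hD : D ∈ Matrix.unitaryGroup β ℂ)
    (h : ∀ k, G * P k * Gᴴ = L' * D * (Lᴴ * P k * L) * Dᴴ * L'ᴴ) :
    (∀ k, (Dᴴ * L'ᴴ * G * L) * (Lᴴ * P k * L) = (Lᴴ * P k * L) * (Dᴴ * L'ᴴ * G * L)) ∧
    G = L' * D * (Dᴴ * L'ᴴ * G * L) * Lᴴ := by
  have hG₁ : Gᴴ * G = 1 := mem_unitaryGroup_iff'.mp hG
  have hL₂ : L * Lᴴ = 1 := mem_unitaryGroup_iff.mp hL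
  have hL'₁ : L'ᴴ * L' = 1 := mem_unitaryGroup_iff'.mp hL'
  have hL'₂ : L' * L'ᴴ = 1 := mem_unitaryGroup_iff.mp hL'
  have hD₁ : Dᴴ * D = 1 := mem_unitaryGroup_iff'.mp hD
  have hD₂ : D * Dᴴ = 1 := mem_unitaryGroup_iff.mp hD
  refine ⟨fun k => ?_, ?_⟩
  · calc (Dᴴ * L'ᴴ * G * L) * (Lᴴ * P k * L)
        = Dᴴ * L'ᴴ * G * (L * Lᴴ) * P k * L := by simp only [Matrix.mul_assoc]
      _ = Dᴴ * L'ᴴ * G * P k * (Gᴴ * G) * L := by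
        rw [hL₂, hG₁, Matrix.mul_one, Matrix.mul_one]
      _ = Dᴴ * L'ᴴ * (G * P k * Gᴴ) * G * L := by simp only [Matrix.mul_assoc]
      _ = Dᴴ * L'ᴴ * (L' * D * (Lᴴ * P k * L) * Dᴴ * L'ᴴ) * G * L := by rw [h k]
      _ = Dᴴ * (L'ᴴ * L') * D * (Lᴴ * P k * L) * (Dᴴ * L'ᴴ * G * L) := by
        simp only [Matrix.mul_assoc]
      _ = (Lᴴ * P k * L) * (Dᴴ * L'ᴴ * G * L) := by
        rw [hL'₁, Matrix.mul_one, hD₁, Matrix.one_mul]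
  · calc
      G = L' * (D * Dᴴ) * L'ᴴ * G * (L * Lᴴ) := by
        rw [hD₂, hL₂, Matrix.mul_one, Matrix.mul_one, hL'₂, Matrix.one_mul]
      _ = L' * D * (Dᴴ * L'ᴴ * G * L) * Lᴴ := by simp only [Matrix.mul_assoc]
end

section
/- Fix N ≥ 1 and work with complex matrices on (Fin N → Fin 2), identified with the N-fold Kronecker product of 2×2 matrices. Let σ₀ = I, σ₁ = X = [[0,1],[1,0]], σ₂ = Y = [[0,−i],[i,0]], σ₃ = Z = [[1,0],[0,−1]], and for s : Fin N → Fin 4 let P(s) denote the Pauli string ⊗_{j=1}^N σ_{s(j)}; let Z_j denote the Pauli string with Z in slot j and identity elsewhere. Let ρ = ⊗_{j=1}^N D_j where each D_j is a diagonal 2×2 matrix with nonnegative real diagonal entries summing to 1. Let S be a unitary matrix such that for every s : Fin N → Fin 4 there exist s' : Fin N → Fin 4 and ε ∈ {1, −1} with S·P(s)·S† = ε·P(s'). Then S·ρ·S† = ρ if and only if Tr[(S·ρ·S† − ρ)·Z_j] = 0 for all j = 1, …, N. -/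
open Matrix

/-- The four single-qubit Pauli matrices I, X, Y, Z. -/
noncomputable def pauli : Fin 4 → Matrix (Fin 2) (Fin 2) ℂ :=
  ![1, !![0, 1; 1, 0], !![0, -Complex.I; Complex.I, 0], !![1, 0; 0, -1]]

/-- The Pauli string ⊗_{j} σ_{s(j)} as a matrix on N qubits, with the
multi-qubit index space `Fin N → Fin 2` and entries given by the product of
the single-qubit entries. -/
noncomputable def pauliString {N : ℕ} (s : Fin N → Fin 4) :
    Matrix (Fin N → Fin 2) (Fin N → Fin 2) ℂ :=
  Matrix.of fun x y => ∏ j, pauli (s j) (x j) (y j)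

/-- Bregman-type inequality behind the nonnegativity of relative entropy. -/
theorem mul_klFun_div {a b : ℝ} (ha : 0 ≤ a) (hb : 0 < b) :
    b * InformationTheory.klFun (a / b) = a * Real.log a - a * Real.log b - a + b := by
  rcases ha.eq_or_lt with rfl | ha
  · simp [InformationTheory.klFun]
  · rw [InformationTheory.klFun, Real.log_div ha.ne' hb.ne']
    field_simp
    ring

/-- If a doubly stochastic matrix preserves the zeros of a nonnegative vector `r` and the
expectation of `log r`, then it only mixes entries of `r` that are equal. -/
theorem eq_zero_or_eq_of_doublyStochastic {ι : Type*} [Fintype ι] {B : ι → ι → ℝ} {r : ι → ℝ}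
    (hB : ∀ x y, 0 ≤ B x y) (hrow : ∀ x, ∑ y, B x y = 1) (hcol : ∀ y, ∑ x, B x y = 1)
    (hr : ∀ x, 0 ≤ r x) (hzero : ∀ x, r x = 0 → ∑ y, B x y * r y = 0)
    (hlog : ∑ x, (∑ y, B x y * r y) * Real.log (r x) = ∑ x, r x * Real.log (r x)) (x y : ι) :
    B x y = 0 ∨ r x = r y := by
  have hBr : ∀ x y, r x = 0 → B x y * r y = 0 := fun x y hx =>
    (Finset.sum_eq_zero_iff_of_nonneg fun y _ => mul_nonneg (hB x y) (hr y)).1 (hzero x hx) y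
      (Finset.mem_univ y)
  set F : ι → ι → ℝ := fun x y =>
    B x y * (r y * Real.log (r y) - r y * Real.log (r x) - r y + r x) with hF
  have hFpos : ∀ x y, 0 < r x → F x y = B x y * (r x * InformationTheory.klFun (r y / r x)) :=
    fun x y hx => by rw [mul_klFun_div (hr y) hx]
  have hFnonneg : ∀ x y, 0 ≤ F x y := by
    intro x y
    rcases (hr x).eq_or_lt with hx | hx
    · have h := hBr x y hx.symm
      have : F x y = B x y * r y * (Real.log (r y) - Real.log (r x) - 1) + B x y * r x := by
        simp only [hF]; ring
      rw [this, h, ← hx]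
      simp
    · rw [hFpos x y hx]
      exact mul_nonneg (hB x y) (mul_nonneg hx.le
        (InformationTheory.klFun_nonneg (div_nonneg (hr y) hx.le)))
  have hmass : ∀ g : ι → ℝ, ∑ x, ∑ y, B x y * g y = ∑ y, g y := by
    intro g
    rw [Finset.sum_comm]
    simp [← Finset.sum_mul, hcol]
  have hsum : ∑ x, ∑ y, F x y = 0 := by
    have h1 : ∀ x y, F x y = B x y * (r y * Real.log (r y)) - B x y * r y * Real.log (r x)
        - B x y * r y + B x y * r x := fun x y => by simp only [hF]; ring
    simp only [h1, Finset.sum_add_distrib, Finset.sum_sub_distrib, hmass]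
    simp only [← Finset.sum_mul, hrow, hlog]
    simp
  have hFzero : F x y = 0 := by
    have h := (Finset.sum_eq_zero_iff_of_nonneg
      fun x _ => Finset.sum_nonneg fun y _ => hFnonneg x y).1 hsum x (Finset.mem_univ x)
    exact (Finset.sum_eq_zero_iff_of_nonneg fun y _ => hFnonneg x y).1 h y (Finset.mem_univ y)
  rcases (hr x).eq_or_lt with hx | hx
  · rcases mul_eq_zero.1 (hBr x y hx.symm) with h | h
    · exact Or.inl h
    · exact Or.inr (hx.symm.trans h.symm)
  · rw [hFpos x y hx] at hFzero
    rcases mul_eq_zero.1 hFzero with h | h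
    · exact Or.inl h
    · right
      have h' := (mul_eq_zero.1 h).resolve_left hx.ne'
      rw [InformationTheory.klFun_eq_zero_iff (div_nonneg (hr y) hx.le),
        div_eq_one_iff_eq hx.ne'] at h'
      exact h'.symm

/-- A nonnegative product vector commutes with any doubly stochastic matrix that preserves all of
its one-site marginals. -/
theorem eq_zero_or_eq_of_marginals {κ α : Type*} [Fintype κ] [Fintype α] [DecidableEq κ]
    [DecidableEq α] {B : (κ → α) → (κ → α) → ℝ} {d : κ → α → ℝ}
    (hB : ∀ x y, 0 ≤ B x y) (hrow : ∀ x, ∑ y, B x y = 1) (hcol : ∀ y, ∑ x, B x y = 1)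
    (hd : ∀ j a, 0 ≤ d j a)
    (hmarg : ∀ (j : κ) (g : α → ℝ),
      ∑ x : κ → α, (∑ y, B x y * ∏ i, d i (y i)) * g (x j) =
        ∑ x : κ → α, (∏ i, d i (x i)) * g (x j))
    (x y : κ → α) : B x y = 0 ∨ ∏ i, d i (x i) = ∏ i, d i (y i) := by
  have hr : ∀ x : κ → α, 0 ≤ ∏ i, d i (x i) := fun x => Finset.prod_nonneg fun i _ => hd i (x i)
  have ht : ∀ x, 0 ≤ ∑ y, B x y * ∏ i, d i (y i) := fun x =>
    Finset.sum_nonneg fun y _ => mul_nonneg (hB x y) (hr y)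
  have hzero : ∀ x : κ → α, ∏ i, d i (x i) = 0 → ∑ y, B x y * ∏ i, d i (y i) = 0 := by
    intro x hx
    obtain ⟨j, -, hj⟩ := Finset.prod_eq_zero_iff.1 hx
    have h := hmarg j fun a => if a = x j then 1 else 0
    have h0 : ∑ z : κ → α, (∏ i, d i (z i)) * (if z j = x j then (1 : ℝ) else 0) = 0 := by
      refine Finset.sum_eq_zero fun z _ => ?_
      split_ifs with hz
      · rw [Finset.prod_eq_zero (Finset.mem_univ j) (by rw [hz, hj]), zero_mul]
      · rw [mul_zero]
    rw [h0] at h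
    have := (Finset.sum_eq_zero_iff_of_nonneg fun z _ =>
      mul_nonneg (ht z) (by split_ifs <;> norm_num)).1 h x (Finset.mem_univ x)
    simpa using this
  have hlog : ∀ u : (κ → α) → ℝ, (∀ x, ∏ i, d i (x i) = 0 → u x = 0) →
      ∑ x, u x * Real.log (∏ i, d i (x i)) = ∑ j, ∑ x, u x * Real.log (d j (x j)) := by
    intro u hu
    rw [Finset.sum_comm]
    refine Finset.sum_congr rfl fun x _ => ?_
    by_cases hx : ∏ i, d i (x i) = 0
    · simp [hu x hx]
    · rw [Real.log_prod (fun i hi => (Finset.prod_ne_zero_iff.1 hx) i hi), Finset.mul_sum]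
  refine eq_zero_or_eq_of_doublyStochastic hB hrow hcol hr hzero ?_ x y
  rw [hlog _ hzero, hlog _ fun _ h => h]
  exact Finset.sum_congr rfl fun j _ => hmarg j fun a => Real.log (d j a)

theorem of_prod_diagonal {κ α : Type*} [Fintype κ] [DecidableEq κ] [DecidableEq α]
    (v : κ → α → ℂ) :
    (Matrix.of fun x y : κ → α => ∏ j, Matrix.diagonal (v j) (x j) (y j)) =
      Matrix.diagonal fun x => ∏ j, v j (x j) := by
  ext x y
  by_cases h : x = y
  · subst h; simp
  · obtain ⟨j, hj⟩ := Function.ne_iff.1 h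
    rw [Matrix.of_apply, Matrix.diagonal_apply_ne _ h]
    exact Finset.prod_eq_zero (Finset.mem_univ j) (Matrix.diagonal_apply_ne _ hj)

theorem pauliString_single_Z {N : ℕ} (j : Fin N) :
    pauliString (fun i => if i = j then (3 : Fin 4) else 0) =
      Matrix.diagonal fun x : Fin N → Fin 2 => (((![1, -1] : Fin 2 → ℝ) (x j) : ℝ) : ℂ) := by
  have h : ∀ i, pauli (if i = j then (3 : Fin 4) else 0) =
      Matrix.diagonal fun a => if i = j then (((![1, -1] : Fin 2 → ℝ) a : ℝ) : ℂ) else 1 := by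
    intro i
    split_ifs
    · ext a b; fin_cases a <;> fin_cases b <;> simp [pauli]
    · ext a b; fin_cases a <;> fin_cases b <;> simp [pauli]
  simp only [pauliString, h]
  rw [of_prod_diagonal]
  congr 1
  ext x
  simp

theorem conj_diagonal_apply_self {ι : Type*} [Fintype ι] [DecidableEq ι] (S : Matrix ι ι ℂ)
    (r : ι → ℝ) (x : ι) :
    (S * Matrix.diagonal (fun y => (r y : ℂ)) * Sᴴ) x x =
      ((∑ y, Complex.normSq (S x y) * r y : ℝ) : ℂ) := by
  rw [Matrix.mul_apply]
  push_cast
  refine Finset.sum_congr rfl fun y _ => ?_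
  rw [Matrix.mul_diagonal, Matrix.conjTranspose_apply, ← Complex.mul_conj]
  simp only [Complex.star_def]
  ring

/-- Theorem 1 (Clifford symmetry testing): a Clifford unitary S is a symmetry
of a factorised, computational-basis-diagonal N-qubit state ρ = ⊗_j D_j if and
only if all single-qubit Z expectation values are preserved. -/
theorem stmt_8 {N : ℕ} (hN : 1 ≤ N)
    (D : Fin N → Matrix (Fin 2) (Fin 2) ℂ)
    (hD : ∀ j, ∃ p q : ℝ, 0 ≤ p ∧ 0 ≤ q ∧ p + q = 1 ∧
      D j = !![(p : ℂ), 0; 0, (q : ℂ)])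
    (ρ : Matrix (Fin N → Fin 2) (Fin N → Fin 2) ℂ)
    (hρ : ρ = Matrix.of fun x y => ∏ j, D j (x j) (y j))
    (S : Matrix (Fin N → Fin 2) (Fin N → Fin 2) ℂ)
    (hS : S ∈ Matrix.unitaryGroup (Fin N → Fin 2) ℂ)
    (hClifford : ∀ s : Fin N → Fin 4, ∃ (s' : Fin N → Fin 4) (ε : ℂ),
      (ε = 1 ∨ ε = -1) ∧ S * pauliString s * Sᴴ = ε • pauliString s') :
    S * ρ * Sᴴ = ρ ↔
      ∀ j : Fin N,
        ((S * ρ * Sᴴ - ρ) *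
            pauliString (fun i => if i = j then (3 : Fin 4) else 0)).trace = 0 := by
  constructor
  · intro h j
    simp [h]
  intro h
  choose p q hp hq _ hDpq using hD
  set d : Fin N → Fin 2 → ℝ := fun j => ![p j, q j] with hd
  have hd0 : ∀ j a, 0 ≤ d j a := by
    intro j a
    fin_cases a
    · exact hp j
    · exact hq j
  have hDd : ∀ j, D j = Matrix.diagonal fun a => (d j a : ℂ) := by
    intro j
    rw [hDpq j]
    ext a b; fin_cases a <;> fin_cases b <;> simp [hd]
  have hρd : ρ = Matrix.diagonal fun x => ((∏ j, d j (x j) : ℝ) : ℂ) := by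
    rw [hρ]
    simp only [hDd]
    rw [of_prod_diagonal]
    push_cast
    rfl
  have hSr : S * Sᴴ = 1 := Matrix.mem_unitaryGroup_iff.1 hS
  have hSl : Sᴴ * S = 1 := Matrix.mem_unitaryGroup_iff'.1 hS
  have hrow : ∀ x, ∑ y, Complex.normSq (S x y) = 1 := by
    intro x
    have h1 := conj_diagonal_apply_self S (fun _ => 1) x
    simp only [Complex.ofReal_one, Matrix.diagonal_one, mul_one, hSr, Matrix.one_apply_eq] at h1
    exact_mod_cast h1.symm
  have hcol : ∀ y, ∑ x, Complex.normSq (S x y) = 1 := by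
    intro y
    have h1 := conj_diagonal_apply_self Sᴴ (fun _ => 1) y
    simp only [Complex.ofReal_one, Matrix.diagonal_one, mul_one, Matrix.conjTranspose_conjTranspose,
      hSl, Matrix.one_apply_eq, Matrix.conjTranspose_apply, Complex.star_def,
      Complex.normSq_conj] at h1
    exact_mod_cast h1.symm
  have htot : ∑ x, ∑ y, Complex.normSq (S x y) * ∏ i, d i (y i) =
      ∑ x : Fin N → Fin 2, ∏ i, d i (x i) := by
    rw [Finset.sum_comm]
    simp only [← Finset.sum_mul, hcol, one_mul]
  have hZ : ∀ j, ∑ x, (∑ y, Complex.normSq (S x y) * ∏ i, d i (y i)) * (![1, -1] : Fin 2 → ℝ) (x j)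
      = ∑ x : Fin N → Fin 2, (∏ i, d i (x i)) * (![1, -1] : Fin 2 → ℝ) (x j) := by
    intro j
    have h1 := h j
    rw [pauliString_single_Z, hρd, Matrix.trace] at h1
    simp only [Matrix.diag_apply, Matrix.mul_diagonal, Matrix.sub_apply,
      Matrix.diagonal_apply_eq] at h1
    simp only [conj_diagonal_apply_self S (fun x => ∏ j, d j (x j)), sub_mul,
      Finset.sum_sub_distrib] at h1
    exact_mod_cast sub_eq_zero.1 h1
  have hmarg : ∀ (j : Fin N) (g : Fin 2 → ℝ),
      ∑ x, (∑ y, Complex.normSq (S x y) * ∏ i, d i (y i)) * g (x j) =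
        ∑ x : Fin N → Fin 2, (∏ i, d i (x i)) * g (x j) := by
    intro j g
    have hg : ∀ a, g a = (g 0 + g 1) / 2 + (![1, -1] : Fin 2 → ℝ) a * ((g 0 - g 1) / 2) := by
      intro a
      fin_cases a
      · simp; ring
      · simp; ring
    have hlin : ∀ u : (Fin N → Fin 2) → ℝ, ∑ x, u x * g (x j) = (∑ x, u x) * ((g 0 + g 1) / 2) +
        (∑ x, u x * (![1, -1] : Fin 2 → ℝ) (x j)) * ((g 0 - g 1) / 2) := by
      intro u
      rw [Finset.sum_mul, Finset.sum_mul, ← Finset.sum_add_distrib]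
      refine Finset.sum_congr rfl fun x _ => ?_
      rw [hg (x j)]
      ring
    rw [hlin, hlin, hZ, htot]
  have hcomm : S * ρ = ρ * S := by
    ext x y
    rw [hρd, Matrix.mul_diagonal, Matrix.diagonal_mul]
    rcases eq_zero_or_eq_of_marginals (fun x y => Complex.normSq_nonneg (S x y)) hrow hcol hd0 hmarg
      x y with h1 | h1
    · simp [Complex.normSq_eq_zero.1 h1]
    · rw [h1, mul_comm]
  rw [hcomm, Matrix.mul_assoc, hSr, Matrix.mul_one]
end

section
/- Let α, β be finite types, let {π_k} be a family of rank-one orthogonal projections on β (π_k† = π_k, π_k² = π_k, Tr π_k = 1) that are pairwise orthogonal and sum to the identity, and let ρ be a positive-semidefinite complex matrix on α × β. Then the following are equivalent: (i) ρ = Σ_k (1 ⊗ π_k)·ρ·(1 ⊗ π_k); (ii) there exist positive-semidefinite matrices Ã_k on α such that ρ = Σ_k Ã_k ⊗ π_k. Moreover, in case (ii) the Ã_k are given by the partial trace Ã_k(a, a') = Σ_{b,b'} ρ((a,b),(a',b')) · π_k(b', b). -/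
open Kronecker Matrix ComplexOrder

/-- The partial trace over the second factor of `ρ * (1 ⊗ₖ P)`. -/
def partialTraceMul {α β : Type*} [Fintype β] (ρ : Matrix (α × β) (α × β) ℂ)
    (P : Matrix β β ℂ) : Matrix α α ℂ :=
  Matrix.of fun a a' => ∑ b, ∑ b', ρ (a, b) (a', b') * P b' b

theorem exists_eq_vecMulVec_of_isIdempotentElem_of_trace_eq_one {β : Type*} [Fintype β]
    [DecidableEq β] {P : Matrix β β ℂ} (hP : IsIdempotentElem P) (htr : P.trace = 1) :
    ∃ u w : β → ℂ, P = vecMulVec u w := by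
  have hid : IsIdempotentElem (toLin' P) := by
    rw [IsIdempotentElem, Module.End.mul_eq_comp, ← toLin'_mul, hP.eq]
  have hrank := (LinearMap.isProj_range_iff_isIdempotentElem _ |>.2 hid).trace
  rw [trace_toLin'_eq, htr] at hrank
  obtain ⟨v, -, hv⟩ := finrank_eq_one_iff'.1 (by exact_mod_cast hrank.symm)
  choose c hc using fun j =>
    hv ⟨toLin' P (Pi.single j 1), LinearMap.mem_range_self _ _⟩
  refine ⟨v, c, ?_⟩
  ext i j
  have h := congrFun (congrArg Subtype.val (hc j)) i
  simp at h
  rw [vecMulVec_apply, ← h, mul_comm]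

theorem vecMulVec_mul_mul_vecMulVec {β : Type*} [Fintype β] (u w : β → ℂ) (M : Matrix β β ℂ) :
    vecMulVec u w * M * vecMulVec u w = (M * vecMulVec u w).trace • vecMulVec u w := by
  rw [vecMulVec_mul, vecMulVec_mul_vecMulVec, mul_vecMulVec, trace_vecMulVec,
    ← dotProduct_mulVec, dotProduct_comm w]
  ext i j
  simp [vecMulVec_apply]
  ring

theorem one_kronecker_mul_mul_one_kronecker_apply {α β : Type*} [Fintype α] [Fintype β]
    [DecidableEq α] (P Q : Matrix β β ℂ) (ρ : Matrix (α × β) (α × β) ℂ) (a a' : α) (b b' : β) :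
    (((1 : Matrix α α ℂ) ⊗ₖ P) * ρ * ((1 : Matrix α α ℂ) ⊗ₖ Q)) (a, b) (a', b') =
      (P * (Matrix.of fun c c' => ρ (a, c) (a', c')) * Q) b b' := by
  simp [Matrix.mul_apply, Fintype.sum_prod_type, Matrix.one_apply, Finset.sum_mul, ite_mul, mul_ite]

theorem one_kronecker_mul_mul_one_kronecker {α β : Type*} [Fintype α] [Fintype β]
    [DecidableEq α] [DecidableEq β] {P : Matrix β β ℂ} (hP : IsIdempotentElem P)
    (htr : P.trace = 1) (ρ : Matrix (α × β) (α × β) ℂ) :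
    ((1 : Matrix α α ℂ) ⊗ₖ P) * ρ * ((1 : Matrix α α ℂ) ⊗ₖ P) = partialTraceMul ρ P ⊗ₖ P := by
  obtain ⟨u, w, rfl⟩ := exists_eq_vecMulVec_of_isIdempotentElem_of_trace_eq_one hP htr
  ext ⟨a, b⟩ ⟨a', b'⟩
  rw [one_kronecker_mul_mul_one_kronecker_apply, vecMulVec_mul_mul_vecMulVec]
  simp [partialTraceMul, trace, Matrix.mul_apply]

theorem Matrix.PosSemidef.partialTraceMul {α β : Type*} [Fintype α] [Fintype β]
    [DecidableEq α] {P : Matrix β β ℂ} (hherm : P.IsHermitian) (hP : IsIdempotentElem P)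
    {ρ : Matrix (α × β) (α × β) ℂ} (hρ : ρ.PosSemidef) : (partialTraceMul ρ P).PosSemidef := by
  let V (c : β) : Matrix (α × β) α ℂ := Matrix.of fun x a => if x.1 = a then P x.2 c else 0
  have h : _root_.partialTraceMul ρ P = ∑ c, (V c)ᴴ * ρ * V c := by
    ext a a'
    simp only [_root_.partialTraceMul, of_apply, Matrix.sum_apply]
    have hentry (c : β) : ((V c)ᴴ * ρ * V c) a a' =
        ∑ b, ∑ b', ρ (a, b) (a', b') * (P b' c * P c b) := by
      have hstar (b : β) : star (P b c) = P c b := hherm.apply c b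
      simp only [V, Matrix.mul_apply, conjTranspose_apply, of_apply, Fintype.sum_prod_type,
        apply_ite star, hstar, star_zero, ite_mul, mul_ite, zero_mul, mul_zero,
        Finset.sum_ite_irrel, Finset.sum_const_zero, Finset.sum_ite_eq', Finset.mem_univ,
        if_true, Finset.sum_mul]
      rw [Finset.sum_comm]
      exact Finset.sum_congr rfl fun b _ => Finset.sum_congr rfl fun b' _ => by ring
    simp_rw [hentry]
    symm
    rw [Finset.sum_comm]
    refine Finset.sum_congr rfl fun b _ => ?_
    rw [Finset.sum_comm]
    refine Finset.sum_congr rfl fun b' _ => ?_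
    rw [← Finset.mul_sum, ← Matrix.mul_apply, hP.eq]
  rw [h]
  exact posSemidef_sum _ fun c _ => hρ.conjTranspose_mul_mul_same (V c)

theorem partialTraceMul_sum_kronecker {α β K : Type*} [Fintype β] [Fintype K]
    (A : K → Matrix α α ℂ) (π : K → Matrix β β ℂ) (P : Matrix β β ℂ) :
    partialTraceMul (∑ k, A k ⊗ₖ π k) P = ∑ k, (π k * P).trace • A k := by
  ext a a'
  simp only [partialTraceMul, of_apply, Matrix.sum_apply, kroneckerMap_apply, Finset.sum_mul,
    Matrix.smul_apply, smul_eq_mul, trace, diag_apply, Matrix.mul_apply]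
  simp_rw [Finset.sum_comm (t := (Finset.univ : Finset K))]
  simp_rw [mul_comm _ (A _ a a'), mul_assoc]

/-- Section III.A: equivalence of the two definitions of quantum-classical
states, together with the partial-trace formula for the unnormalised
conditional density matrices. -/
theorem stmt_9 {α β K : Type*} [Fintype α] [Fintype β] [Fintype K]
    [DecidableEq α] [DecidableEq β]
    (π : K → Matrix β β ℂ)
    (hherm : ∀ k, (π k)ᴴ = π k) (hidem : ∀ k, π k * π k = π k)
    (htr : ∀ k, (π k).trace = 1)
    (horth : ∀ k k', k ≠ k' → π k * π k' = 0)
    (hsum : ∑ k, π k = 1)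
    (ρ : Matrix (α × β) (α × β) ℂ) (hρ : ρ.PosSemidef) :
    ((ρ = ∑ k, ((1 : Matrix α α ℂ) ⊗ₖ π k) * ρ * ((1 : Matrix α α ℂ) ⊗ₖ π k)) ↔
      (∃ A : K → Matrix α α ℂ, (∀ k, (A k).PosSemidef) ∧ ρ = ∑ k, A k ⊗ₖ π k)) ∧
    (∀ A : K → Matrix α α ℂ, (∀ k, (A k).PosSemidef) → ρ = ∑ k, A k ⊗ₖ π k →
      ∀ k, A k = Matrix.of fun a a' => ∑ b, ∑ b', ρ (a, b) (a', b') * π k b' b) := by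
  classical
  have hmul (k j : K) : π k * π j = if k = j then π k else 0 := by
    split_ifs with h
    · rw [← h, hidem]
    · exact horth k j h
  refine ⟨⟨fun h => ⟨fun k => partialTraceMul ρ (π k), fun k => hρ.partialTraceMul (hherm k)
    (hidem k), h.trans <| Finset.sum_congr rfl fun k _ =>
      one_kronecker_mul_mul_one_kronecker (hidem k) (htr k) ρ⟩, ?_⟩, ?_⟩
  · rintro ⟨A, -, rfl⟩
    simp [Finset.mul_sum, ← mul_kronecker_mul, hmul, apply_ite (kroneckerMap _ _)]
  · rintro A - rfl k
    change A k = partialTraceMul _ (π k)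
    simp [partialTraceMul_sum_kronecker, hmul, apply_ite trace, htr]
end

section
/- Let ρ be a Hermitian complex matrix on a finite index type n such that Tr ρ = Tr(ρ²) = Tr(ρ³) = 1. Then ρ is a rank-one orthogonal projection: ρ² = ρ and ρ has rank 1. -/
open Matrix

/-- The trace of a power of a Hermitian matrix is the corresponding power sum of its
eigenvalues. -/
theorem Matrix.IsHermitian.trace_pow_eq_sum_eigenvalues_pow {n : Type*} [Fintype n]
    [DecidableEq n] {A : Matrix n n ℂ} (hA : A.IsHermitian) (k : ℕ) :
    (A ^ k).trace = ((∑ i, hA.eigenvalues i ^ k : ℝ) : ℂ) := by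
  conv_lhs => rw [hA.spectral_theorem, ← map_pow, Unitary.conjStarAlgAut_apply,
    Matrix.trace_mul_cycle, Unitary.coe_star_mul_self, one_mul, Matrix.diagonal_pow,
    Matrix.trace_diagonal]
  simp

/-- Real numbers whose second and third power sums are both `1` all lie in `{0, 1}`. -/
theorem eq_zero_or_eq_one_of_sum_sq_of_sum_cube {ι : Type*} [Fintype ι] {x : ι → ℝ}
    (h2 : ∑ i, x i ^ 2 = 1) (h3 : ∑ i, x i ^ 3 = 1) (i : ι) : x i = 0 ∨ x i = 1 := by
  have hle (j : ι) : x j ≤ 1 := by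
    have := Finset.single_le_sum (f := fun i => x i ^ 2) (fun i _ => sq_nonneg (x i))
      (Finset.mem_univ j)
    simp only [h2] at this
    nlinarith
  have hsum : ∑ j, x j ^ 2 * (1 - x j) = 0 := by
    calc ∑ j, x j ^ 2 * (1 - x j) = ∑ j, x j ^ 2 - ∑ j, x j ^ 3 := by
          rw [← Finset.sum_sub_distrib]
          exact Finset.sum_congr rfl fun j _ => by ring
      _ = 0 := by rw [h2, h3, sub_self]
  have hi := (Finset.sum_eq_zero_iff_of_nonneg fun j _ =>
    mul_nonneg (sq_nonneg (x j)) (sub_nonneg.2 (hle j))).1 hsum i (Finset.mem_univ i)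
  rcases mul_eq_zero.1 hi with h | h
  · exact Or.inl (pow_eq_zero_iff two_ne_zero |>.1 h)
  · exact Or.inr (sub_eq_zero.1 h).symm

/-- Purity criterion of Section IV.A: a Hermitian matrix with
Tr ρ = Tr ρ² = Tr ρ³ = 1 is a rank-one orthogonal projection. -/
theorem stmt_10 {n : Type*} [Fintype n] [DecidableEq n]
    (ρ : Matrix n n ℂ) (hherm : ρ.IsHermitian)
    (h1 : ρ.trace = 1) (h2 : (ρ * ρ).trace = 1) (h3 : (ρ * ρ * ρ).trace = 1) :
    ρ * ρ = ρ ∧ ρ.rank = 1 := by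
  have s1 : ∑ i, hherm.eigenvalues i = 1 := by
    have h := hherm.trace_pow_eq_sum_eigenvalues_pow 1
    simp only [pow_one, h1] at h
    exact_mod_cast h.symm
  have s2 : ∑ i, hherm.eigenvalues i ^ 2 = 1 := by
    have h := hherm.trace_pow_eq_sum_eigenvalues_pow 2
    rw [pow_two, h2] at h
    exact_mod_cast h.symm
  have s3 : ∑ i, hherm.eigenvalues i ^ 3 = 1 := by
    have h := hherm.trace_pow_eq_sum_eigenvalues_pow 3
    rw [pow_three', h3] at h
    exact_mod_cast h.symm
  have h01 := eq_zero_or_eq_one_of_sum_sq_of_sum_cube s2 s3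
  constructor
  · rw [hherm.spectral_theorem, ← map_mul, Matrix.diagonal_mul_diagonal]
    congr 2
    funext i
    rcases h01 i with h | h <;> simp [h]
  · rw [hherm.rank_eq_card_non_zero_eigs, Fintype.card_subtype, Finset.card_filter,
      ← Nat.cast_inj (R := ℝ), Nat.cast_one, ← s1, Nat.cast_sum]
    refine Finset.sum_congr rfl fun i _ => ?_
    rcases h01 i with h | h <;> simp [h]
end

section
/- Let x : Fin n → ℝ be real numbers satisfying Σ_i x_i = Σ_i x_i² = Σ_i x_i³ = 1. Then x_i ∈ {0, 1} for every i, and there is exactly one index i with x_i = 1. -/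
/-- Eigenvalue form of the purity criterion (Section IV.A): real numbers whose
first three power sums all equal 1 consist of exactly one 1 and the rest 0. -/
theorem stmt_11 {n : ℕ} (x : Fin n → ℝ)
    (h1 : ∑ i, x i = 1) (h2 : ∑ i, (x i) ^ 2 = 1) (h3 : ∑ i, (x i) ^ 3 = 1) :
    (∀ i, x i = 0 ∨ x i = 1) ∧ (∃! i, x i = 1) := by
  have hle : ∀ i, x i ≤ 1 := fun i => by
    have hi : x i ^ 2 ≤ ∑ j, x j ^ 2 :=
      Finset.single_le_sum (fun j _ => sq_nonneg (x j)) (Finset.mem_univ i)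
    nlinarith
  have hsum : ∑ i, x i ^ 2 * (1 - x i) = 0 := by
    calc ∑ i, x i ^ 2 * (1 - x i) = ∑ i, (x i ^ 2 - x i ^ 3) :=
          Finset.sum_congr rfl fun i _ => by ring
      _ = 0 := by rw [Finset.sum_sub_distrib, h2, h3, sub_self]
  have hzero := (Finset.sum_eq_zero_iff_of_nonneg fun i _ =>
    mul_nonneg (sq_nonneg (x i)) (sub_nonneg.2 (hle i))).1 hsum
  have h01 : ∀ i, x i = 0 ∨ x i = 1 := fun i =>
    (mul_eq_zero.1 (hzero i (Finset.mem_univ i))).imp (pow_eq_zero_iff two_ne_zero).1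
      fun h => (sub_eq_zero.1 h).symm
  obtain ⟨i, -, hi⟩ := Finset.exists_ne_zero_of_sum_ne_zero (h1.trans_ne one_ne_zero)
  have hi1 : x i = 1 := (h01 i).resolve_left hi
  refine ⟨h01, i, hi1, fun j hj => ?_⟩
  by_contra hji
  have hpair : ∑ k ∈ {j, i}, x k ^ 2 ≤ ∑ k, x k ^ 2 :=
    Finset.sum_le_sum_of_subset_of_nonneg (Finset.subset_univ _) fun k _ _ => sq_nonneg (x k)
  rw [Finset.sum_pair hji, h2, hi1, hj] at hpair
  norm_num at hpair
end

section
/- Let P be a complex matrix on a finite index type n that is an orthogonal projection (P† = P, P² = P) of rank r, all of whose entries have rational real part and rational imaginary part. Then there exist r rank-one orthogonal projections P₁, …, P_r, pairwise orthogonal (P_i · P_j = 0 for i ≠ j), each of whose entries have rational real part and rational imaginary part, such that P = P₁ + ⋯ + P_r. -/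
open Matrix

/-- A complex number with rational real and imaginary parts. -/
def IsGaussianRat (z : ℂ) : Prop := ∃ a b : ℚ, z = (a : ℂ) + (b : ℂ) * Complex.I

namespace IsGaussianRat

lemma sub {z w : ℂ} (hz : IsGaussianRat z) (hw : IsGaussianRat w) : IsGaussianRat (z - w) := by
  obtain ⟨a, b, rfl⟩ := hz
  obtain ⟨c, d, rfl⟩ := hw
  exact ⟨a - c, b - d, by push_cast; ring⟩

lemma mul {z w : ℂ} (hz : IsGaussianRat z) (hw : IsGaussianRat w) : IsGaussianRat (z * w) := by
  obtain ⟨a, b, rfl⟩ := hz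
  obtain ⟨c, d, rfl⟩ := hw
  refine ⟨a * c - b * d, a * d + b * c, ?_⟩
  push_cast
  linear_combination (b * d : ℂ) * Complex.I_mul_I

lemma inv {z : ℂ} (hz : IsGaussianRat z) : IsGaussianRat z⁻¹ := by
  obtain ⟨a, b, rfl⟩ := hz
  refine ⟨a / (a * a + b * b), -b / (a * a + b * b), ?_⟩
  apply Complex.ext <;> simp [Complex.inv_re, Complex.inv_im, Complex.normSq_apply,
    ← Complex.ofReal_ratCast, ← Complex.ofReal_mul, ← Complex.ofReal_add, ← Complex.ofReal_div,
    ← Complex.ofReal_neg]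

end IsGaussianRat

namespace Matrix

variable {n : Type*} [Fintype n] [DecidableEq n]

lemma trace_eq_rank_of_isIdempotentElem {K : Type*} [Field K] {P : Matrix n n K}
    (hP : IsIdempotentElem P) : P.trace = P.rank := by
  have h : IsIdempotentElem (toLin' P) := by
    rw [IsIdempotentElem, Module.End.mul_eq_comp, ← toLin'_mul, hP.eq]
  rw [← trace_toLin'_eq, (LinearMap.IsIdempotentElem.isProj_range _ h).trace]
  rfl

lemma single_mul_mul_single_same {R : Type*} [CommSemiring R] (P : Matrix n n R) (j : n) :
    single j j 1 * P * single j j 1 = P j j • single j j 1 := by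
  rw [single_mul_mul_single, smul_single]
  simp

/-- A projection with nonzero `j`-th diagonal entry dominates the rank-one projection onto the
span of its `j`-th column. -/
lemma exists_rankOne_projection_le {P : Matrix n n ℂ} (hherm : Pᴴ = P) (hidem : P * P = P)
    (hrat : ∀ i j, IsGaussianRat (P i j)) {j : n} (hj : P j j ≠ 0) :
    ∃ Q : Matrix n n ℂ, Qᴴ = Q ∧ Q * Q = Q ∧ Q.trace = 1 ∧ P * Q = Q ∧ Q * P = Q ∧
      ∀ a b, IsGaussianRat (Q a b) := by
  have hE := single_mul_mul_single_same P j
  have hc : star (P j j) = P j j := by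
    rw [← conjTranspose_apply, hherm]
  refine ⟨(P j j)⁻¹ • (P * single j j 1 * P), ?_, ?_, ?_, ?_, ?_, fun a b => ?_⟩
  · rw [conjTranspose_smul, conjTranspose_mul, conjTranspose_mul, hherm, star_inv₀, hc,
      conjTranspose_single, star_one, mul_assoc]
  · have : P * single j j 1 * P * (P * single j j 1 * P) =
        P j j • (P * single j j 1 * P) := by
      calc _ = P * (single j j 1 * (P * P) * single j j 1) * P := by simp only [mul_assoc]
        _ = _ := by rw [hidem, hE, Matrix.mul_smul, Matrix.smul_mul]
    rw [Matrix.smul_mul, Matrix.mul_smul, this, inv_smul_smul₀ hj]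
  · rw [trace_smul, trace_mul_comm, ← mul_assoc, hidem, trace_mul_comm, trace_single_mul]
    simp [hj]
  · rw [Matrix.mul_smul, ← mul_assoc, ← mul_assoc, hidem]
  · rw [Matrix.smul_mul, mul_assoc _ P P, hidem]
  · have h : ((P j j)⁻¹ • (P * single j j 1 * P) : Matrix n n ℂ) a b =
        (P j j)⁻¹ * (P a j * P j b) := by
      rw [smul_apply, smul_eq_mul, mul_apply, Finset.sum_eq_single j]
      · simp
      · intro k _ hk
        simp [mul_single_apply_of_ne, hk]
      · simp
    rw [h]
    exact (hrat j j).inv.mul ((hrat a j).mul (hrat j b))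

lemma exists_sum_rankOne_projections_of_trace (r : ℕ) (P : Matrix n n ℂ)
    (hherm : Pᴴ = P) (hidem : P * P = P) (htr : P.trace = r)
    (hrat : ∀ i j, IsGaussianRat (P i j)) :
    ∃ Q : Fin r → Matrix n n ℂ,
      (∀ k, (Q k)ᴴ = Q k) ∧
      (∀ k, Q k * Q k = Q k) ∧
      (∀ k, (Q k).trace = 1) ∧
      (∀ k l, k ≠ l → Q k * Q l = 0) ∧
      (∀ k i j, IsGaussianRat (Q k i j)) ∧
      P = ∑ k, Q k := by
  induction r generalizing P with
  | zero =>
    have hP : P = 0 := by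
      open scoped ComplexOrder in
      rw [← trace_conjTranspose_mul_self_eq_zero_iff, hherm, hidem, htr, Nat.cast_zero]
    exact ⟨Fin.elim0, fun k => k.elim0, fun k => k.elim0, fun k => k.elim0, fun k => k.elim0,
      fun k => k.elim0, by simp [hP]⟩
  | succ r ih =>
    obtain ⟨j, hj⟩ : ∃ j, P j j ≠ 0 := by
      by_contra! h
      have h0 : P.trace = 0 := Finset.sum_eq_zero fun j _ => h j
      rw [htr] at h0
      exact Nat.cast_ne_zero.mpr r.succ_ne_zero h0
    obtain ⟨R, hRh, hRi, hRt, hPR, hRP, hRr⟩ :=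
      exists_rankOne_projection_le hherm hidem hrat hj
    obtain ⟨Q, hQh, hQi, hQt, hQo, hQr, hQs⟩ := ih (P - R)
      (by rw [conjTranspose_sub, hherm, hRh])
      (by rw [sub_mul, mul_sub, mul_sub, hidem, hPR, hRP, hRi, sub_self, sub_zero])
      (by rw [trace_sub, htr, hRt]; push_cast; ring)
      (fun a b => (hrat a b).sub (hRr a b))
    have hQP (k) : Q k * (P - R) = Q k := by
      rw [hQs, Finset.mul_sum, Finset.sum_eq_single k (fun l _ hl => hQo k l hl.symm) (by simp),
        hQi]
    have hQR (k) : Q k * R = 0 := by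
      rw [← hQP k, mul_assoc, sub_mul, hPR, hRi, sub_self, mul_zero]
    have hRQ (k) : R * Q k = 0 := by
      rw [← hRh, ← hQh k, ← conjTranspose_mul, hQR, conjTranspose_zero]
    refine ⟨Fin.cons R Q, Fin.cases hRh hQh, Fin.cases hRi hQi, Fin.cases hRt hQt, ?_,
      Fin.cases hRr hQr, ?_⟩
    · intro k l
      refine Fin.cases ?_ (fun k => ?_) k <;> refine Fin.cases ?_ (fun l => ?_) l
      · simp
      · exact fun _ => hRQ l
      · exact fun _ => hQR k
      · simpa using hQo k l
    · rw [Fin.sum_univ_succ]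
      simp [← hQs]

end Matrix

/-- Part (ii) of the proof of Lemma 3 (Section IV.B): an orthogonal projection
of rank r all of whose entries have rational real and imaginary parts
decomposes as a sum of r pairwise-orthogonal rational rank-one orthogonal
projections. -/
theorem stmt_13 {n : Type*} [Fintype n] [DecidableEq n]
    (P : Matrix n n ℂ) (r : ℕ)
    (hherm : Pᴴ = P) (hidem : P * P = P) (hrank : P.rank = r)
    (hrat : ∀ i j, ∃ a b : ℚ, P i j = (a : ℂ) + (b : ℂ) * Complex.I) :
    ∃ Q : Fin r → Matrix n n ℂ,
      (∀ k, (Q k)ᴴ = Q k) ∧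
      (∀ k, Q k * Q k = Q k) ∧
      (∀ k, (Q k).trace = 1) ∧
      (∀ k l, k ≠ l → Q k * Q l = 0) ∧
      (∀ k i j, ∃ a b : ℚ, Q k i j = (a : ℂ) + (b : ℂ) * Complex.I) ∧
      P = ∑ k, Q k := by
  exact exists_sum_rankOne_projections_of_trace r P hherm hidem
    (by rw [trace_eq_rank_of_isIdempotentElem hidem, hrank]) hrat
end
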